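/- arXiv:math/0609390 — 2 statements merged into one kernel-verified Lean document; each statement's English description precedes it below -/
import Mathlib

section
/- Let 0 ≤ k ≤ n−1 and let P ∈ χ^k(R). Then, as elements of M ⊗_R Ω^{n−k−1}(R), ∑_{σ ∈ S_{k+1,n−k−1}} ε(σ) ∑_{1≤i<j≤k+1} (−1)^{i+j} P({X_{σ(i)},X_{σ(j)}}, X_{σ(1)},…,X_{σ(k+1)} omitting X_{σ(i)} and X_{σ(j)}) ⊗ dX_{σ(k+2)}∧⋯∧dX_{σ(n)} = (−1)^{k+1} ∑_{τ ∈ S_{k,1,n−k−1}} ε(τ) (∑_{l=1}^{k} a_{τ(k+1),τ(l)}) X_{τ(k+1)} P(X_{τ(1)},…,X_{τ(k)}) ⊗ dX_{τ(k+2)}∧⋯∧dX_{τ(n)}. -/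
open MvPolynomial

noncomputable section

abbrev Rp (n : ℕ) := MvPolynomial (Fin n) ℂ

abbrev cIdx (n : ℕ) (k : ℤ) := {s : Finset (Fin n) // (s.card : ℤ) = k}

/-- The free `R`-module `M ⊗_R Ω^k(R)` on the basis of increasing wedges `dX_S`. -/
abbrev Ch (n : ℕ) (k : ℤ) := cIdx n k → Rp n

/-- The Poisson bracket on `ℂ[X_1,…,X_n]` with `{X i, X j} = a i j • X i X j`. -/
def pb {n : ℕ} (a : Fin n → Fin n → ℤ) (f g : Rp n) : Rp n :=
  ∑ i : Fin n, ∑ j : Fin n,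
    C ((a i j : ℂ)) * X i * X j * pderiv i f * pderiv j g

/-- The element `m ⊗ dX_{i_1} ∧ ⋯ ∧ dX_{i_j}` of `M ⊗_R Ω^j(R)`, where
`S = {i_1 < ⋯ < i_j}`. -/
def elt {n : ℕ} {k : ℤ} (m : Rp n) (S : Finset (Fin n)) : Ch n k :=
  fun T => if T.1 = S then m else 0

/-- `P` belongs to `χ^k(R)`: it is multilinear, skew-symmetric, and a derivation in
each of its arguments. -/
def IsChi {n k : ℕ} (P : (Fin k → Rp n) → Rp n) : Prop :=
  (∀ (v : Fin k → Rp n) (i : Fin k) (x y : Rp n),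
      P (Function.update v i (x + y)) = P (Function.update v i x) + P (Function.update v i y)) ∧
  (∀ (v : Fin k → Rp n) (i : Fin k) (c : ℂ) (x : Rp n),
      P (Function.update v i (c • x)) = c • P (Function.update v i x)) ∧
  (∀ (v : Fin k → Rp n) (g : Equiv.Perm (Fin k)),
      P (v ∘ g) = ((Equiv.Perm.sign g : ℤ) : ℂ) • P v) ∧
  (∀ (v : Fin k → Rp n) (i : Fin k) (x y : Rp n),
      P (Function.update v i (x * y)) = x * P (Function.update v i y) + y * P (Function.update v i x))

/-- `S_{k+1,n-k-1}` : permutations increasing on (0-based) positions `0,…,k` and on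
positions `k+1,…,n-1`. -/
def Sbig (n k : ℕ) (σ : Equiv.Perm (Fin n)) : Prop :=
  (∀ p q : Fin n, p < q → (q : ℕ) ≤ k → σ p < σ q) ∧
  (∀ p q : Fin n, p < q → k + 1 ≤ (p : ℕ) → σ p < σ q)

/-- `S_{k,1,n-k-1}` : permutations increasing on (0-based) positions `0,…,k-1` and on
positions `k+1,…,n-1`. -/
def Smid (n k : ℕ) (τ : Equiv.Perm (Fin n)) : Prop :=
  (∀ p q : Fin n, p < q → (q : ℕ) < k → τ p < τ q) ∧
  (∀ p q : Fin n, p < q → k + 1 ≤ (p : ℕ) → τ p < τ q)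

instance (n k : ℕ) : DecidablePred (Sbig n k) := fun σ => by unfold Sbig; infer_instance
instance (n k : ℕ) : DecidablePred (Smid n k) := fun τ => by unfold Smid; infer_instance

/-- The set `{σ(k+2), …, σ(n)}` (1-based), i.e. the image under `σ` of the last
`n-k-1` positions. -/
def tailSet {n : ℕ} (k : ℕ) (hk : k + 1 ≤ n) (σ : Equiv.Perm (Fin n)) : Finset (Fin n) :=
  Finset.image (fun t : Fin (n - (k + 1)) => σ ⟨k + 1 + (t : ℕ), by omega⟩) Finset.univ

/-- sign of a permutation, as a complex number. -/
def sgnC {m : ℕ} (σ : Equiv.Perm (Fin m)) : ℂ := ((Equiv.Perm.sign σ : ℤ) : ℂ)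

/-- The `(m+1)`-st element (0-based `m`-th) of `{0,…,k}` with `i` and `j` removed. -/
def cmpl {k : ℕ} (i j : Fin (k + 1)) (m : ℕ) : Fin (k + 1) :=
  (((List.finRange (k + 1)).filter (fun x : Fin (k + 1) => decide (x ≠ i ∧ x ≠ j)))).getD m i

theorem IsChi.comp_perm {n k : ℕ} {P : (Fin k → Rp n) → Rp n} (hP : IsChi P)
    (v : Fin k → Rp n) (g : Equiv.Perm (Fin k)) : P (v ∘ g) = sgnC g • P v :=
  hP.2.2.1 v g

theorem IsChi.map_cons_succAbove {n m : ℕ} {P : (Fin (m + 1) → Rp n) → Rp n} (hP : IsChi P)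
    (v : Fin (m + 1) → Rp n) (p : Fin (m + 1)) :
    P (Fin.cons (v p) (v ∘ p.succAbove)) = (-1 : ℂ) ^ (p : ℕ) • P v := by
  have h : (Fin.cons (v p) (v ∘ p.succAbove) : Fin (m + 1) → Rp n) = v ∘ p.cycleRange.symm :=
    Fin.cons_removeNth_eq_comp_cycleRange_symm v p
  rw [h, hP.comp_perm]
  simp [sgnC]

theorem IsChi.map_cons_mul {n m : ℕ} {P : (Fin (m + 1) → Rp n) → Rp n} (hP : IsChi P)
    (c : ℂ) (x y : Rp n) (v : Fin m → Rp n) :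
    P (Fin.cons (c • (x * y)) v) =
      c • (x * P (Fin.cons y v) + y * P (Fin.cons x v)) := by
  have h1 := hP.2.1 (Fin.cons 0 v) 0 c (x * y)
  have h2 := hP.2.2.2 (Fin.cons 0 v) 0 x y
  simp only [Fin.update_cons_zero] at h1 h2
  rw [h1, h2]

theorem cmpl_eq_of_strictMono {m : ℕ} {i j : Fin (m + 2)} (hij : i ≠ j)
    {f : Fin m → Fin (m + 2)} (hf : StrictMono f) (hi : ∀ l, f l ≠ i) (hj : ∀ l, f l ≠ j)
    (l : Fin m) : cmpl (k := m + 1) i j l = f l := by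
  have himg : Finset.univ.image f = {i, j}ᶜ := by
    apply Finset.eq_of_subset_of_card_le
    · intro x hx
      obtain ⟨l, -, rfl⟩ := Finset.mem_image.1 hx
      simp [hi, hj]
    · rw [Finset.card_image_of_injective _ hf.injective, Finset.card_compl, Finset.card_pair hij]
      simp
  have hlist : (List.finRange (m + 2)).filter (fun x => decide (x ≠ i ∧ x ≠ j)) = List.ofFn f := by
    apply List.SortedLT.eq_of_mem_iff
    · exact ((List.sortedLT_finRange _).pairwise.filter _).sortedLT
    · exact List.sortedLT_ofFn_iff.2 hf
    · intro x
      have := Finset.ext_iff.1 himg x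
      simp only [Finset.mem_image, Finset.mem_univ, true_and, Finset.mem_compl, Finset.mem_insert,
        Finset.mem_singleton] at this
      simp [List.mem_ofFn, this]
  unfold cmpl
  rw [hlist]
  simp

theorem IsChi.map_mul_cmpl {n m : ℕ} {P : (Fin (m + 1) → Rp n) → Rp n} (hP : IsChi P)
    (c : ℂ) (w : Fin (m + 2) → Rp n) {i j : Fin (m + 2)} (hij : i < j) :
    (-1 : ℂ) ^ ((i : ℕ) + (j : ℕ)) •
      P (fun l : Fin (m + 1) => if (l : ℕ) = 0 then c • (w i * w j)
        else w (cmpl (k := m + 1) i j ((l : ℕ) - 1))) =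
      c • ((-1 : ℂ) ^ ((i : ℕ) + 1) • (w i * P (w ∘ i.succAbove))) -
      c • ((-1 : ℂ) ^ ((j : ℕ) + 1) • (w j * P (w ∘ j.succAbove))) := by
  have hj0 : j ≠ 0 := (Fin.zero_le i).trans_lt hij |>.ne'
  have hil : i ≠ Fin.last _ := (hij.trans_le (Fin.le_last j)).ne
  have hj' : i.succAbove (j.pred hj0) = j := Fin.succAbove_pred_of_lt _ _ hij
  have hi' : j.succAbove (i.castPred hil) = i := Fin.succAbove_castPred_of_lt _ _ hij
  have hfun : (fun l : Fin (m + 1) => if (l : ℕ) = 0 then c • (w i * w j)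
        else w (cmpl (k := m + 1) i j ((l : ℕ) - 1))) =
      Fin.cons (c • (w i * w j)) (fun l : Fin m => w (cmpl (k := m + 1) i j l)) := by
    funext l
    refine Fin.cases ?_ (fun l => ?_) l <;> simp
  have e1 : (fun l : Fin m => w (cmpl (k := m + 1) i j l)) =
      (w ∘ i.succAbove) ∘ (j.pred hj0).succAbove := by
    funext l
    rw [cmpl_eq_of_strictMono hij.ne (f := i.succAbove ∘ (j.pred hj0).succAbove)]
    · rfl
    · exact (Fin.strictMono_succAbove _).comp (Fin.strictMono_succAbove _)
    · intro l; exact Fin.succAbove_ne _ _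
    · intro l h
      exact Fin.succAbove_ne _ _ (Fin.succAbove_right_injective (h.trans hj'.symm))
  have e2 : (fun l : Fin m => w (cmpl (k := m + 1) i j l)) =
      (w ∘ j.succAbove) ∘ (i.castPred hil).succAbove := by
    funext l
    rw [cmpl_eq_of_strictMono hij.ne (f := j.succAbove ∘ (i.castPred hil).succAbove)]
    · rfl
    · exact (Fin.strictMono_succAbove _).comp (Fin.strictMono_succAbove _)
    · intro l h
      exact Fin.succAbove_ne _ _ (Fin.succAbove_right_injective (h.trans hi'.symm))
    · intro l; exact Fin.succAbove_ne _ _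
  have h1 := hP.map_cons_succAbove (w ∘ i.succAbove) (j.pred hj0)
  have h2 := hP.map_cons_succAbove (w ∘ j.succAbove) (i.castPred hil)
  rw [← e1, Function.comp_apply, hj'] at h1
  rw [← e2, Function.comp_apply, hi'] at h2
  rw [hfun, hP.map_cons_mul, h1, h2]
  obtain ⟨j, rfl⟩ := Fin.exists_succ_eq.2 hj0
  simp only [Fin.pred_succ, Fin.val_succ, Fin.coe_castPred, mul_smul_comm, smul_add, smul_smul]
  have hs : ∀ p : ℕ, (-1 : ℂ) ^ p * (-1 : ℂ) ^ p = 1 := fun p => by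
    rw [← mul_pow]; simp
  rw [sub_eq_add_neg, ← neg_smul]
  congr 2
  · linear_combination (-c * (-1) ^ (i : ℕ)) * hs j
  · linear_combination (-c * (-1) ^ (j : ℕ)) * hs i

theorem pb_X_X {n : ℕ} (a : Fin n → Fin n → ℤ) (p q : Fin n) :
    pb a (X p) (X q) = (a p q : ℂ) • (X p * X q : Rp n) := by
  unfold pb
  rw [Finset.sum_eq_single p, Finset.sum_eq_single q]
  · simp [smul_eq_C_mul, mul_assoc]
  · intro b _ hb; simp [pderiv_X_of_ne hb.symm]
  · simp
  · intro b _ hb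
    simp [pderiv_X_of_ne hb.symm]
  · simp

theorem sum_lt_sub_eq_sum_succAbove {E : Type*} [AddCommGroup E] [Module ℂ E] {m : ℕ}
    (b : Fin (m + 1) → Fin (m + 1) → ℂ) (hb : ∀ i j, b j i = -b i j) (G : Fin (m + 1) → E) :
    (∑ i, ∑ j, if i < j then b i j • G i - b i j • G j else 0) =
      ∑ i, (∑ l, b i (i.succAbove l)) • G i := by
  have hd : ∀ i, b i i = 0 := fun i => self_eq_neg.1 (hb i i)
  have h1 : ∀ i, (∑ l, b i (i.succAbove l)) • G i = ∑ j, b i j • G i := fun i => by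
    rw [← Finset.sum_smul, Fin.sum_univ_succAbove _ i, hd, zero_add]
  have h2 : ∀ i j, (if i < j then b i j • G i - b i j • G j else 0) =
      (if i < j then b i j • G i else 0) + (if i < j then b j i • G j else 0) := fun i j => by
    split_ifs
    · rw [hb i j, neg_smul, sub_eq_add_neg]
    · simp
  simp only [h1, h2, Finset.sum_add_distrib]
  rw [Finset.sum_comm (f := fun i j => if i < j then b j i • G j else 0),
    ← Finset.sum_add_distrib]
  refine Finset.sum_congr rfl fun i _ => ?_
  rw [← Finset.sum_add_distrib]
  refine Finset.sum_congr rfl fun j _ => ?_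
  rcases lt_trichotomy i j with h | rfl | h
  · simp [h, h.not_gt]
  · simp [hd]
  · simp [h, h.not_gt]

theorem elt_smul {n : ℕ} {k : ℤ} (c : ℂ) (x : Rp n) (S : Finset (Fin n)) :
    (elt (c • x) S : Ch n k) = c • elt x S := by
  funext T
  simp [elt]

theorem elt_sub {n : ℕ} {k : ℤ} (x y : Rp n) (S : Finset (Fin n)) :
    (elt (x - y) S : Ch n k) = elt x S - elt y S := by
  funext T
  simp only [elt, Pi.sub_apply]
  split_ifs <;> simp

theorem IsChi.sum_bracket_eq {n m : ℕ} {d : ℤ} (a : Fin n → Fin n → ℤ) (ha : ∀ i j, a j i = -a i j)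
    {P : (Fin (m + 1) → Rp n) → Rp n} (hP : IsChi P) (s : Fin (m + 2) → Fin n)
    (S : Finset (Fin n)) :
    (∑ i : Fin (m + 2), ∑ j : Fin (m + 2),
        (if i < j then
          (-1 : ℂ) ^ ((i : ℕ) + (j : ℕ)) •
            (elt (P (fun l : Fin (m + 1) =>
                if (l : ℕ) = 0 then pb a (X (s i)) (X (s j))
                else X (s (cmpl (k := m + 1) i j ((l : ℕ) - 1))))) S : Ch n d)
        else 0)) =
      ∑ i : Fin (m + 2), (-1 : ℂ) ^ ((i : ℕ) + 1) • (∑ l, (a (s i) (s (i.succAbove l)) : ℂ)) •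
        (elt (X (s i) * P (fun l => X (s (i.succAbove l)))) S : Ch n d) := by
  have h := sum_lt_sub_eq_sum_succAbove (fun i j => (a (s i) (s j) : ℂ))
    (fun i j => by simp [ha (s i) (s j)])
    (fun i => (elt ((-1 : ℂ) ^ ((i : ℕ) + 1) • (X (s i) * P (fun l => X (s (i.succAbove l))))) S :
      Ch n d))
  trans
  · refine Eq.trans ?_ h
    refine Finset.sum_congr rfl fun i _ => Finset.sum_congr rfl fun j _ => ?_
    split_ifs with hij
    · have := hP.map_mul_cmpl (a (s i) (s j) : ℂ) (fun i => X (s i)) hij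
      rw [← elt_smul, pb_X_X, this, elt_sub, elt_smul (a _ _ : ℂ),
        elt_smul (a _ _ : ℂ)]
      rfl
    · rfl
  · refine Finset.sum_congr rfl fun i _ => ?_
    rw [elt_smul, smul_comm]

section MoveToEnd

variable {n k : ℕ}

/-- The permutation that moves position `i` to position `k`, keeping the order of the other
positions. -/
def moveToEnd (hk : k + 1 ≤ n) (i : Fin (k + 1)) : Equiv.Perm (Fin n) :=
  Fin.cycleIcc (Fin.castLE hk i) (Fin.castLE hk (Fin.last k))

theorem moveToEnd_last (hk : k + 1 ≤ n) (i : Fin (k + 1)) :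
    moveToEnd hk i ⟨k, hk⟩ = Fin.castLE hk i := by
  have : NeZero n := ⟨by omega⟩
  exact Fin.cycleIcc_of_last (i := Fin.castLE hk i) (j := Fin.castLE hk (Fin.last k)) i.le_last

theorem moveToEnd_castLE (hk : k + 1 ≤ n) (i : Fin (k + 1)) (l : Fin k) :
    moveToEnd hk i (Fin.castLE (Nat.le_of_lt hk) l) = Fin.castLE hk (i.succAbove l) := by
  have : NeZero n := ⟨by omega⟩
  unfold moveToEnd
  rcases lt_or_ge l.castSucc i with h | h
  · rw [Fin.succAbove_of_castSucc_lt _ _ h, Fin.cycleIcc_of_lt]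
    · rfl
    · exact h
  · rw [Fin.succAbove_of_le_castSucc _ _ h, Fin.cycleIcc_of_ge_of_lt]
    · apply Fin.ext
      rw [Fin.val_add_one_of_lt']
      · simp
      · simp; omega
    · exact h
    · exact Fin.lt_def.2 l.2

theorem moveToEnd_of_lt (hk : k + 1 ≤ n) (i : Fin (k + 1)) (p : Fin n) (hp : k < p) :
    moveToEnd hk i p = p :=
  Fin.cycleIcc_of_gt hp

theorem sgnC_mul_moveToEnd (hk : k + 1 ≤ n) (σ : Equiv.Perm (Fin n)) (i : Fin (k + 1)) :
    sgnC (σ * moveToEnd hk i) = sgnC σ * (-1) ^ (k + (i : ℕ)) := by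
  have h : Equiv.Perm.sign (moveToEnd hk i) = (-1) ^ (k - (i : ℕ)) :=
    Fin.sign_cycleIcc_of_le (i := Fin.castLE hk i) (j := Fin.castLE hk (Fin.last k)) i.le_last
  have e : k + (i : ℕ) = (k - i) + 2 * i := by omega
  rw [sgnC, sgnC, map_mul, h, e, pow_add, pow_mul]
  simp

theorem tailSet_mul_moveToEnd (hk : k + 1 ≤ n) (σ : Equiv.Perm (Fin n)) (i : Fin (k + 1)) :
    tailSet k hk (σ * moveToEnd hk i) = tailSet k hk σ := by
  unfold tailSet
  congr 1
  funext t
  rw [Equiv.Perm.mul_apply, moveToEnd_of_lt]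
  simp; omega

theorem Sbig.strictMono_castLE {σ : Equiv.Perm (Fin n)} (hσ : Sbig n k σ) (hk : k + 1 ≤ n) :
    StrictMono fun i : Fin (k + 1) => σ (Fin.castLE hk i) := fun _ j hij =>
  hσ.1 _ _ hij (Nat.lt_succ_iff.1 j.2)

theorem Sbig.mul_moveToEnd {σ : Equiv.Perm (Fin n)} (hσ : Sbig n k σ) (hk : k + 1 ≤ n)
    (i : Fin (k + 1)) : Smid n k (σ * moveToEnd hk i) := by
  constructor
  · intro p q hpq hq
    have hp : (p : ℕ) < k := lt_trans hpq hq
    have := hσ.strictMono_castLE hk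
      (Fin.strictMono_succAbove i (show (⟨p, hp⟩ : Fin k) < ⟨q, hq⟩ from hpq))
    simp only [← moveToEnd_castLE] at this
    exact this
  · intro p q hpq hp
    have hq : k < (q : ℕ) := lt_trans hp hpq
    rw [Equiv.Perm.mul_apply, Equiv.Perm.mul_apply, moveToEnd_of_lt _ _ _ hp,
      moveToEnd_of_lt _ _ _ hq]
    exact hσ.2 p q hpq hp

theorem Sbig.mul_moveToEnd_lt_iff {σ : Equiv.Perm (Fin n)} (hσ : Sbig n k σ) (hk : k + 1 ≤ n)
    (i : Fin (k + 1)) (l : Fin k) :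
    (σ * moveToEnd hk i) (Fin.castLE (Nat.le_of_lt hk) l) < (σ * moveToEnd hk i) ⟨k, hk⟩ ↔
      l.castSucc < i := by
  rw [Equiv.Perm.mul_apply, Equiv.Perm.mul_apply, moveToEnd_castLE, moveToEnd_last]
  exact (hσ.strictMono_castLE hk).lt_iff_lt.trans (Fin.succAbove_lt_iff_castSucc_lt i l)

theorem mul_moveToEnd_injective (hk : k + 1 ≤ n) {σ₁ σ₂ : Equiv.Perm (Fin n)}
    (h₁ : Sbig n k σ₁) (h₂ : Sbig n k σ₂) {i₁ i₂ : Fin (k + 1)}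
    (h : σ₁ * moveToEnd hk i₁ = σ₂ * moveToEnd hk i₂) : σ₁ = σ₂ ∧ i₁ = i₂ := by
  have hi : ∀ l : Fin k, l.castSucc < i₁ ↔ l.castSucc < i₂ := fun l => by
    rw [← h₁.mul_moveToEnd_lt_iff hk, ← h₂.mul_moveToEnd_lt_iff hk, h]
  have hi' : i₁ = i₂ := by
    rcases lt_trichotomy i₁ i₂ with hlt | he | hlt
    · have := (hi ⟨i₁, by omega⟩).2 hlt
      exact absurd this (lt_irrefl i₁)
    · exact he
    · have := (hi ⟨i₂, by omega⟩).1 hlt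
      exact absurd this (lt_irrefl i₂)
  subst hi'
  exact ⟨mul_right_cancel h, rfl⟩

theorem Smid.exists_lt_iff {τ : Equiv.Perm (Fin n)} (hτ : Smid n k τ) (hk : k + 1 ≤ n) :
    ∃ i : Fin (k + 1), ∀ l : Fin k,
      τ (Fin.castLE (Nat.le_of_lt hk) l) < τ ⟨k, hk⟩ ↔ l.castSucc < i := by
  classical
  have hex : ∃ p : ℕ, ∀ l : Fin k, (l : ℕ) = p → τ ⟨k, hk⟩ < τ (Fin.castLE (Nat.le_of_lt hk) l) :=
    ⟨k, fun l hl => absurd hl l.2.ne⟩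
  have hle : Nat.find hex ≤ k := Nat.find_min' hex fun l hl => absurd hl l.2.ne
  refine ⟨⟨Nat.find hex, Nat.lt_succ_iff.2 hle⟩, fun l => ⟨fun h => ?_, fun h => ?_⟩⟩
  · by_contra hl
    have hl : Nat.find hex ≤ l := not_lt.1 hl
    have h1 := Nat.find_spec hex ⟨Nat.find hex, hl.trans_lt l.2⟩ rfl
    rcases hl.eq_or_lt with he | hlt
    · exact lt_asymm h (by simpa only [he] using h1)
    · exact lt_asymm h (h1.trans (hτ.1 _ _ hlt l.2))
  · have h1 := Nat.find_min hex h
    push Not at h1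
    obtain ⟨l', hl', h2⟩ := h1
    obtain rfl : l' = l := Fin.ext hl'
    exact h2.lt_of_ne fun he => l'.2.ne (congrArg Fin.val (τ.injective he))

theorem Smid.exists_eq_mul_moveToEnd {τ : Equiv.Perm (Fin n)} (hτ : Smid n k τ)
    (hk : k + 1 ≤ n) :
    ∃ σ, Sbig n k σ ∧ ∃ i : Fin (k + 1), σ * moveToEnd hk i = τ := by
  obtain ⟨i, hi⟩ := hτ.exists_lt_iff hk
  obtain ⟨σ, rfl⟩ : ∃ σ, σ * moveToEnd hk i = τ := ⟨τ * (moveToEnd hk i)⁻¹, by group⟩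
  refine ⟨σ, ⟨fun p q hpq hq => ?_, fun p q hpq hp => ?_⟩, i, rfl⟩
  · have hlast : ∀ l : Fin k, σ (Fin.castLE hk (i.succAbove l)) < σ (Fin.castLE hk i) ↔
        i.succAbove l < i := fun l => by
      rw [Fin.succAbove_lt_iff_castSucc_lt, ← hi l, Equiv.Perm.mul_apply, Equiv.Perm.mul_apply,
        moveToEnd_castLE, moveToEnd_last]
    have key : ∀ x y : Fin (k + 1), x < y → σ (Fin.castLE hk x) < σ (Fin.castLE hk y) := by
      intro x y hxy
      rcases Fin.eq_self_or_eq_succAbove i x with rfl | ⟨x, rfl⟩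
      · rcases Fin.eq_self_or_eq_succAbove x y with rfl | ⟨y, rfl⟩
        · exact absurd hxy (lt_irrefl _)
        · refine lt_of_le_of_ne (not_lt.1 fun h => lt_asymm hxy ((hlast y).1 h)) fun h => ?_
          exact hxy.ne (Fin.castLE_injective hk (σ.injective h))
      · rcases Fin.eq_self_or_eq_succAbove i y with rfl | ⟨y, rfl⟩
        · exact (hlast x).2 hxy
        · have hxy' : x < y := (Fin.strictMono_succAbove i).lt_iff_lt.1 hxy
          have := hτ.1 (Fin.castLE (Nat.le_of_lt hk) x) (Fin.castLE (Nat.le_of_lt hk) y) hxy' y.2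
          rwa [Equiv.Perm.mul_apply, Equiv.Perm.mul_apply, moveToEnd_castLE,
            moveToEnd_castLE] at this
    exact key ⟨p, Nat.lt_succ_iff.2 (le_trans (le_of_lt hpq) hq)⟩ ⟨q, Nat.lt_succ_iff.2 hq⟩ hpq
  · have hq : k < (q : ℕ) := lt_trans hp hpq
    have := hτ.2 p q hpq hp
    rwa [Equiv.Perm.mul_apply, Equiv.Perm.mul_apply, moveToEnd_of_lt _ _ _ hp,
      moveToEnd_of_lt _ _ _ hq] at this

theorem sum_Smid_eq_sum_Sbig {E : Type*} [AddCommMonoid E] (hk : k + 1 ≤ n)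
    (f : Equiv.Perm (Fin n) → E) :
    ∑ τ ∈ Finset.univ.filter (Smid n k), f τ =
      ∑ σ ∈ Finset.univ.filter (Sbig n k), ∑ i : Fin (k + 1), f (σ * moveToEnd hk i) := by
  rw [← Finset.sum_product']
  symm
  refine Finset.sum_bij (fun x _ => x.1 * moveToEnd hk x.2) ?_ ?_ ?_ fun _ _ => rfl
  · intro x hx
    simp only [Finset.mem_product, Finset.mem_filter, Finset.mem_univ, true_and, and_true] at hx ⊢
    exact hx.mul_moveToEnd hk x.2
  · intro x hx y hy h
    simp only [Finset.mem_product, Finset.mem_filter, Finset.mem_univ, true_and, and_true] at hx hy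
    exact Prod.ext_iff.2 (mul_moveToEnd_injective hk hx hy h)
  · intro τ hτ
    obtain ⟨σ, hσ, i, h⟩ := (Finset.mem_filter.1 hτ).2.exists_eq_mul_moveToEnd hk
    exact ⟨(σ, i), by simpa using hσ, h⟩

end MoveToEnd

/-- for `0 ≤ k ≤ n−1` and `P ∈ χ^k(R)`, in `M ⊗_R Ω^{n−k−1}(R)`:
`∑_{σ ∈ S_{k+1,n−k−1}} ε(σ) ∑_{1≤i<j≤k+1} (−1)^{i+j} P({X_{σ(i)},X_{σ(j)}}, X_{σ(1)},…,omit σ(i),σ(j),…) ⊗ dX_{σ(k+2)}∧⋯∧dX_{σ(n)}`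
`= (−1)^{k+1} ∑_{τ ∈ S_{k,1,n−k−1}} ε(τ) (∑_{l=1}^k a_{τ(k+1),τ(l)}) X_{τ(k+1)} P(X_{τ(1)},…,X_{τ(k)}) ⊗ dX_{τ(k+2)}∧⋯∧dX_{τ(n)}`
(0-based positions; the 1-based sign `(−1)^{i+j}` becomes `(−1)^{i+j}` 0-based since parities agree). -/
theorem stmt7
    (n : ℕ) (a : Fin n → Fin n → ℤ) (ha : ∀ i j, a j i = - a i j)
    (k : ℕ) (hk : k + 1 ≤ n)
    (P : (Fin k → Rp n) → Rp n) (hP : IsChi P) :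
    (∑ σ ∈ Finset.univ.filter (Sbig n k),
      sgnC σ • ∑ i : Fin (k + 1), ∑ j : Fin (k + 1),
        (if i < j then
          (-1 : ℂ) ^ ((i : ℕ) + (j : ℕ)) •
            (elt (P (fun l : Fin k =>
                if (l : ℕ) = 0 then
                  pb a (X (σ (Fin.castLE hk i))) (X (σ (Fin.castLE hk j)))
                else X (σ (Fin.castLE hk (cmpl i j ((l : ℕ) - 1))))))
              (tailSet k hk σ) : Ch n ((n : ℤ) - k - 1))
        else 0))
    = (-1 : ℂ) ^ (k + 1) •
      ∑ τ ∈ Finset.univ.filter (Smid n k),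
        sgnC τ •
          (∑ l : Fin k, ((a (τ ⟨k, by omega⟩) (τ (Fin.castLE (by omega) l)) : ℤ) : ℂ)) •
            (elt (X (τ ⟨k, by omega⟩) *
                P (fun l : Fin k => X (τ (Fin.castLE (by omega) l))))
              (tailSet k hk τ) : Ch n ((n : ℤ) - k - 1)) := by
  rcases k with _ | m
  · simp
  · rw [sum_Smid_eq_sum_Sbig hk, Finset.smul_sum]
    refine Finset.sum_congr rfl fun σ _ => ?_
    rw [hP.sum_bracket_eq a ha (fun i => σ (Fin.castLE hk i)), Finset.smul_sum, Finset.smul_sum]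
    refine Finset.sum_congr rfl fun i _ => ?_
    rw [sgnC_mul_moveToEnd, tailSet_mul_moveToEnd]
    simp only [Equiv.Perm.mul_apply, moveToEnd_last, moveToEnd_castLE]
    simp only [smul_smul]
    congr 1
    generalize (∑ l : Fin (m + 1), (_ : ℂ)) = s
    have hs : (-1 : ℂ) ^ m * (-1 : ℂ) ^ m = 1 := by rw [← mul_pow]; simp
    linear_combination (sgnC σ * s * (-1) ^ (i : ℕ)) * hs
end
end

section
/- (Proposition: Poisson homology of R with values in M.) For every k with 0 ≤ k ≤ n, the classes of the elements X^α dX^β with β ∈ {0,1}^n, |β| = k, α ∈ ℕ^n, and α + β ∈ C form a ℂ-basis of HP_k(R,M); i.e. HP_k(R,M) = ⊕_{|β|=k, α+β∈C} ℂ·X^α dX^β. -/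
open MvPolynomial

noncomputable section

def bML {n : ℕ} (a : Fin n → Fin n → ℤ) (u : Fin n) : Rp n →ₗ[ℂ] Rp n :=
  LinearMap.mulLeft ℂ (C (∑ l : Fin n, (a u l : ℂ)) * X u)
    - ∑ j : Fin n, (LinearMap.mulLeft ℂ (C ((a u j : ℂ)) * X u * X j)).comp
        (pderiv j).toLinearMap

/-- The boundary of the Poisson homology complex of `R` with values in `M`
(the true boundary `C_j → C_{j-1}` when `k = j - 1`). -/
def bnd {n : ℕ} (a : Fin n → Fin n → ℤ) (j k : ℤ) : Ch n j →ₗ[ℂ] Ch n k :=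
  LinearMap.pi fun T : cIdx n k =>
    ∑ u : Fin n,
      if u ∈ T.1 then 0
      else if hc : ((insert u T.1).card : ℤ) = j then
        ((-1 : ℂ) ^ ((T.1.filter (fun w => w < u)).card)) •
          ((bML a u + (∑ w ∈ T.1, (a w u : ℂ)) • LinearMap.mulLeft ℂ (X u)).comp
            (LinearMap.proj (⟨insert u T.1, hc⟩ : cIdx n j)))
      else 0

/-- The basis element `X^α dX^β` of `C_k`, `β` being encoded by a subset `S`. -/
def bas {n : ℕ} {k : ℤ} (α : Fin n →₀ ℕ) (S : Finset (Fin n)) : Ch n k :=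
  fun T => if T.1 = S then monomial α 1 else 0

/-- Membership in `C = {γ ∈ ℕ^n : ∀ i, γ_i = 0 or ∑_j a_{ij}(γ_j − 1) = 0}`. -/
def CsetPred {n : ℕ} (a : Fin n → Fin n → ℤ) (γ : Fin n → ℕ) : Prop :=
  ∀ i, γ i = 0 ∨ ∑ j : Fin n, a i j * ((γ j : ℤ) - 1) = 0

/-- The Poisson cycles `ker ∂_k`. -/
def Zc {n : ℕ} (a : Fin n → Fin n → ℤ) (k : ℤ) : Submodule ℂ (Ch n k) :=
  LinearMap.ker (bnd a k (k - 1))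

/-- The Poisson boundaries `im ∂_{k+1}`, as a submodule of the cycles. -/
def Bc {n : ℕ} (a : Fin n → Fin n → ℤ) (k : ℤ) : Submodule ℂ (Zc a k) :=
  (LinearMap.range (bnd a (k + 1) k)).comap (Zc a k).subtype

/-- The Poisson homology `HP_k(R,M) = ker ∂_k / im ∂_{k+1}`. -/
def HPhom (n : ℕ) (a : Fin n → Fin n → ℤ) (k : ℤ) : Type :=
  Zc (n := n) a k ⧸ Bc a k

/-- The index set: pairs `(α, β)` with `β ∈ {0,1}^n`, `|β| = k` and `α + β ∈ C`. -/
def IdxH (n : ℕ) (a : Fin n → Fin n → ℤ) (k : ℤ) : Type :=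
  {p : (Fin n →₀ ℕ) × Finset (Fin n) //
    ((p.2.card : ℤ) = k ∧ CsetPred a (fun i => p.1 i + if i ∈ p.2 then 1 else 0))}

instance (n : ℕ) (a : Fin n → Fin n → ℤ) (k : ℤ) : AddCommGroup (HPhom n a k) := by
  unfold HPhom; infer_instance

instance (n : ℕ) (a : Fin n → Fin n → ℤ) (k : ℤ) : Module ℂ (HPhom n a k) := by
  unfold HPhom; infer_instance

/-- The scalar by which `∂` contracts the direction `u` in weight `γ`. -/
def weightScalar {n : ℕ} (a : Fin n → Fin n → ℤ) (γ : Fin n →₀ ℕ) (u : Fin n) : ℂ :=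
  - ∑ j : Fin n, (a u j : ℂ) * ((γ j : ℂ) - 1)

/-- The exponent vector of the squarefree monomial with support `S`. -/
def indicatorExp {n : ℕ} (S : Finset (Fin n)) : Fin n →₀ ℕ :=
  Finsupp.equivFunOnFinite.symm fun i => if i ∈ S then 1 else 0

/-- The Koszul sign of inserting `u` into `T`. -/
def koszulSign {n : ℕ} (T : Finset (Fin n)) (u : Fin n) : ℂ :=
  (-1 : ℂ) ^ ((T.filter (fun w => w < u)).card)

/-- The Koszul differential with scalars `c`, on coefficient functions. -/
def koszulD {n : ℕ} (c : Fin n → ℂ) (F : Finset (Fin n) → ℂ) (T : Finset (Fin n)) : ℂ :=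
  ∑ u : Fin n, if u ∈ T then 0 else koszulSign T u * (c u * F (insert u T))

/-- The contracting homotopy of the Koszul differential in the direction `v`. -/
def koszulH {n : ℕ} (c : Fin n → ℂ) (v : Fin n) (F : Finset (Fin n) → ℂ)
    (T : Finset (Fin n)) : ℂ :=
  if v ∈ T then koszulSign (T.erase v) v * ((c v)⁻¹ * F (T.erase v)) else 0

/-- The coefficient of `X^(γ - S) dX^S` in the chain `f`. -/
def weightCoeff {n : ℕ} {k : ℤ} (f : Ch n k) (γ : Fin n →₀ ℕ) (S : Finset (Fin n)) : ℂ :=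
  if h : (S.card : ℤ) = k then
    if S ⊆ γ.support then coeff (γ - indicatorExp S) (f ⟨S, h⟩) else 0
  else 0

lemma indicatorExp_apply {n : ℕ} (S : Finset (Fin n)) (i : Fin n) :
    indicatorExp S i = if i ∈ S then 1 else 0 := rfl

lemma indicatorExp_le {n : ℕ} {S : Finset (Fin n)} {γ : Fin n →₀ ℕ} (h : S ⊆ γ.support) :
    indicatorExp S ≤ γ := by
  intro i
  rw [indicatorExp_apply]
  split_ifs with hi
  · have := Finsupp.mem_support_iff.1 (h hi)
    omega
  · omega

lemma subset_support_add_indicatorExp {n : ℕ} (S : Finset (Fin n)) (α : Fin n →₀ ℕ) :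
    S ⊆ (α + indicatorExp S).support := by
  intro i hi
  simp [indicatorExp_apply, hi]

lemma weightCoeff_add {n : ℕ} {k : ℤ} (f : Ch n k) (α : Fin n →₀ ℕ) (T : cIdx n k) :
    weightCoeff f (α + indicatorExp T.1) T.1 = coeff α (f T) := by
  rw [weightCoeff, dif_pos T.2, if_pos (subset_support_add_indicatorExp _ _), add_tsub_cancel_right]

lemma koszulSign_mul_self {n : ℕ} (T : Finset (Fin n)) (u : Fin n) :
    koszulSign T u * koszulSign T u = 1 := by
  rw [koszulSign, ← mul_pow]; simp

lemma koszulSign_insert {n : ℕ} {T : Finset (Fin n)} {u v : Fin n} (hu : u ∉ T) :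
    koszulSign (insert u T) v = (if u < v then -1 else 1) * koszulSign T v := by
  unfold koszulSign
  rw [Finset.filter_insert]
  split_ifs with h
  · rw [Finset.card_insert_of_notMem (by simp [hu]), pow_succ]; ring
  · simp

/-- The two ways of inserting two distinct elements have opposite signs. -/
lemma koszulSign_swap {n : ℕ} {T : Finset (Fin n)} {u v : Fin n} (hu : u ∉ T) (hv : v ∉ T)
    (huv : u ≠ v) :
    koszulSign (insert v T) u * koszulSign (insert u T) v
      = - (koszulSign T v * koszulSign T u) := by
  rw [koszulSign_insert hu, koszulSign_insert hv]
  rcases lt_or_gt_of_ne huv with h | h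
  · rw [if_neg (not_lt.2 h.le), if_pos h]; ring
  · rw [if_pos h, if_neg (not_lt.2 h.le)]; ring

lemma koszulD_koszulH {n : ℕ} (c : Fin n → ℂ) {v : Fin n} (hv : c v ≠ 0)
    (F : Finset (Fin n) → ℂ) (hF : ∀ T, koszulD c F T = 0) (T : Finset (Fin n)) :
    koszulD c (koszulH c v F) T = F T := by
  by_cases hvT : v ∈ T
  · obtain ⟨T, hvT', rfl⟩ : ∃ T', v ∉ T' ∧ insert v T' = T :=
      ⟨T.erase v, by simp, Finset.insert_erase hvT⟩
    have key : koszulD c (koszulH c v F) (insert v T) + koszulSign T v * ((c v)⁻¹ * koszulD c F T)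
        = F (insert v T) := by
      unfold koszulD
      rw [Finset.mul_sum, Finset.mul_sum, ← Finset.sum_add_distrib,
        Finset.sum_eq_single v]
      · rw [if_pos (Finset.mem_insert_self _ _), if_neg hvT', zero_add]
        calc _ = (koszulSign T v * koszulSign T v) * ((c v)⁻¹ * c v) * F (insert v T) := by ring
          _ = _ := by rw [koszulSign_mul_self, inv_mul_cancel₀ hv]; ring
      · intro u _ huv
        by_cases huT : u ∈ T
        · simp [huT]
        · have hne : u ∉ insert v T := by simp [huv, huT]
          rw [if_neg hne, if_neg huT, koszulH, if_pos (by simp), Finset.insert_comm,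
            Finset.erase_insert (by simp [hvT', huv.symm])]
          linear_combination (c u * (c v)⁻¹ * F (insert u T)) * koszulSign_swap huT hvT' huv
      · simp
    rwa [hF, mul_zero, mul_zero, add_zero] at key
  · unfold koszulD
    rw [Finset.sum_eq_single v]
    · rw [if_neg hvT, koszulH, if_pos (by simp), Finset.erase_insert hvT]
      calc _ = (koszulSign T v * koszulSign T v) * (c v * (c v)⁻¹) * F T := by ring
        _ = _ := by rw [koszulSign_mul_self, mul_inv_cancel₀ hv]; ring
    · intro u _ huv
      split_ifs with h
      · rfl
      · rw [koszulH, if_neg (by simp [hvT, huv.symm])]; simp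
    · simp

lemma coeff_X_mul_pderiv {n : ℕ} (j : Fin n) (p : Rp n) (α : Fin n →₀ ℕ) :
    coeff α (X j * pderiv j p) = (α j : ℂ) * coeff α p := by
  induction p using MvPolynomial.induction_on' with
  | monomial β r =>
    rw [X_mul_pderiv_monomial, coeff_smul, coeff_monomial]
    split_ifs with h
    · subst h; simp
    · simp
  | add p q hp hq => rw [map_add, mul_add, coeff_add, coeff_add, hp, hq, mul_add]

lemma bML_apply {n : ℕ} (a : Fin n → Fin n → ℤ) (u : Fin n) (p : Rp n) :
    bML a u p = X u * (C (∑ l : Fin n, (a u l : ℂ)) * p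
      - ∑ j : Fin n, C (a u j : ℂ) * (X j * pderiv j p)) := by
  rw [bML, LinearMap.sub_apply, LinearMap.sum_apply, mul_sub, Finset.mul_sum,
    LinearMap.mulLeft_apply]
  refine congrArg₂ _ (by ring) (Finset.sum_congr rfl fun j _ => ?_)
  rw [LinearMap.comp_apply, LinearMap.mulLeft_apply]
  change C (a u j : ℂ) * X u * X j * pderiv j p = _
  ring

lemma coeff_bML_add {n : ℕ} (a : Fin n → Fin n → ℤ) (ha : ∀ i j, a j i = - a i j)
    {T : Finset (Fin n)} {u : Fin n} (p : Rp n) (α : Fin n →₀ ℕ) :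
    coeff α ((bML a u + (∑ w ∈ T, (a w u : ℂ)) • LinearMap.mulLeft ℂ (X u) :
        Rp n →ₗ[ℂ] Rp n) p)
      = weightScalar a (α + indicatorExp T) u *
        (if u ∈ α.support then coeff (α - Finsupp.single u 1) p else 0) := by
  have h1 : (bML a u + (∑ w ∈ T, (a w u : ℂ)) • LinearMap.mulLeft ℂ (X u) :
        Rp n →ₗ[ℂ] Rp n) p
      = X u * (C (∑ l : Fin n, (a u l : ℂ)) * p - ∑ j : Fin n, C (a u j : ℂ) * (X j * pderiv j p)
        + C (∑ w ∈ T, (a w u : ℂ)) * p) := by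
    rw [LinearMap.add_apply, bML_apply, LinearMap.smul_apply, LinearMap.mulLeft_apply,
      smul_eq_C_mul]
    ring
  rw [h1, coeff_X_mul']
  split_ifs with hα
  · obtain ⟨δ, rfl⟩ : ∃ δ, α = δ + Finsupp.single u 1 := by
      refine ⟨α - Finsupp.single u 1, (tsub_add_cancel_of_le ?_).symm⟩
      rw [Finsupp.single_le_iff]
      have := Finsupp.mem_support_iff.1 hα
      omega
    rw [add_tsub_cancel_right]
    simp only [coeff_add, coeff_sub, coeff_sum, coeff_C_mul, coeff_X_mul_pderiv]
    have huu : (a u u : ℂ) = 0 := by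
      have := ha u u
      have h0 : a u u = 0 := by omega
      simp [h0]
    have hw : ∑ w ∈ T, (a w u : ℂ) = - ∑ j : Fin n, (a u j : ℂ) * (indicatorExp T j : ℂ) := by
      simp only [indicatorExp_apply, Nat.cast_ite, Nat.cast_one, Nat.cast_zero, mul_ite, mul_one,
        mul_zero, Finset.sum_ite_mem, Finset.univ_inter, ← Finset.sum_neg_distrib]
      refine Finset.sum_congr rfl fun j _ => ?_
      rw [ha u j]; push_cast; ring
    have hs : ∑ j : Fin n, (a u j : ℂ) * (Finsupp.single u 1 j : ℕ) = 0 := by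
      rw [Finset.sum_eq_single u] <;> simp +contextual [huu, eq_comm]
    have hc : weightScalar a (δ + Finsupp.single u 1 + indicatorExp T) u
        = ∑ l : Fin n, (a u l : ℂ) - ∑ j : Fin n, (a u j : ℂ) * (δ j : ℂ)
          + ∑ w ∈ T, (a w u : ℂ) := by
      rw [hw, weightScalar]
      simp only [Finsupp.add_apply, Nat.cast_add, mul_sub, mul_add, Finset.sum_sub_distrib,
        Finset.sum_add_distrib, hs, mul_one]
      ring
    rw [hc, add_mul, sub_mul, Finset.sum_mul _ _ (coeff δ p)]
    simp only [Finset.sum_mul, mul_assoc]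
  · simp

/-- In each weight the boundary is the Koszul differential. -/
lemma coeff_bnd {n : ℕ} (a : Fin n → Fin n → ℤ) (ha : ∀ i j, a j i = - a i j) {j k : ℤ}
    (f : Ch n j) (T : cIdx n k) (α : Fin n →₀ ℕ) :
    coeff α (bnd a j k f T) = koszulD (weightScalar a (α + indicatorExp T.1))
      (weightCoeff f (α + indicatorExp T.1)) T.1 := by
  simp only [bnd, LinearMap.pi_apply, LinearMap.sum_apply, coeff_sum, koszulD]
  refine Finset.sum_congr rfl fun u _ => ?_
  split_ifs with hu hc
  · simp
  · rw [LinearMap.smul_apply, coeff_smul, LinearMap.comp_apply, coeff_bML_add a ha, smul_eq_mul,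
      koszulSign, weightCoeff, dif_pos hc]
    have hiff : insert u T.1 ⊆ (α + indicatorExp T.1).support ↔ u ∈ α.support := by
      rw [Finset.insert_subset_iff]
      simp [subset_support_add_indicatorExp, indicatorExp_apply, hu]
    have hsub : α + indicatorExp T.1 - indicatorExp (insert u T.1) = α - Finsupp.single u 1 := by
      ext i
      simp only [Finsupp.tsub_apply, Finsupp.add_apply, indicatorExp_apply, Finset.mem_insert,
        Finsupp.single_apply]
      by_cases hi : i = u
      · subst hi; simp [hu]
      · by_cases hiT : i ∈ T.1 <;> simp [hi, hiT, Ne.symm hi]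
    simp only [hiff, hsub, LinearMap.proj_apply]
  · rw [weightCoeff, dif_neg hc]; simp

lemma weightCoeff_bnd {n : ℕ} (a : Fin n → Fin n → ℤ) (ha : ∀ i j, a j i = - a i j) (j : ℤ)
    (f : Ch n j) (γ : Fin n →₀ ℕ) (T : Finset (Fin n)) :
    weightCoeff (bnd a j (j - 1) f) γ T = koszulD (weightScalar a γ) (weightCoeff f γ) T := by
  rw [weightCoeff]
  split_ifs with hc hT
  · rw [coeff_bnd a ha, tsub_add_cancel_of_le (indicatorExp_le hT)]
  · refine (Finset.sum_eq_zero fun u _ => ?_).symm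
    split_ifs with hu
    · rfl
    · have : ¬ insert u T ⊆ γ.support := fun h => hT ((Finset.subset_insert _ _).trans h)
      simp [weightCoeff, this]
  · refine (Finset.sum_eq_zero fun u _ => ?_).symm
    split_ifs with hu
    · rfl
    · have : ¬ (((insert u T).card : ℤ) = j) := by
        rw [Finset.card_insert_of_notMem hu]; push_cast; omega
      rw [weightCoeff, dif_neg this]; simp

lemma weightScalar_eq_zero_iff {n : ℕ} (a : Fin n → Fin n → ℤ) (γ : Fin n →₀ ℕ) (u : Fin n) :
    weightScalar a γ u = 0 ↔ ∑ j : Fin n, a u j * ((γ j : ℤ) - 1) = 0 := by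
  rw [weightScalar, neg_eq_zero]
  exact_mod_cast Iff.rfl

/-- In the weights belonging to `C` the differential vanishes. -/
lemma koszulD_eq_zero_of_CsetPred {n : ℕ} {a : Fin n → Fin n → ℤ} {γ : Fin n →₀ ℕ}
    (hγ : CsetPred a γ) {k : ℤ} (f : Ch n k) (T : Finset (Fin n)) :
    koszulD (weightScalar a γ) (weightCoeff f γ) T = 0 := by
  refine Finset.sum_eq_zero fun u _ => ?_
  split_ifs with hu
  · rfl
  · rcases hγ u with h | h
    · have : ¬ insert u T ⊆ γ.support := fun hs =>
        Finsupp.mem_support_iff.1 (hs (Finset.mem_insert_self _ _)) h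
      simp [weightCoeff, this]
    · rw [(weightScalar_eq_zero_iff a γ u).2 h]; simp

lemma exists_coeff_eq {n : ℕ} (g : (Fin n →₀ ℕ) → ℂ) (hg : (Function.support g).Finite) :
    ∃ p : Rp n, ∀ α, coeff α p = g α := by
  refine ⟨∑ α ∈ hg.toFinset, monomial α (g α), fun α => ?_⟩
  simp only [coeff_sum, coeff_monomial, Finset.sum_ite_eq', Set.Finite.mem_toFinset,
    Function.mem_support]
  split_ifs with h
  · rfl
  · exact (not_not.1 h).symm

lemma finite_support_weightCoeff {n : ℕ} {k : ℤ} (f : Ch n k) (S : Finset (Fin n)) :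
    (Function.support fun γ => weightCoeff f γ S).Finite := by
  by_cases h : (S.card : ℤ) = k
  · refine ((f ⟨S, h⟩).support.finite_toSet.image (· + indicatorExp S)).subset fun γ hγ => ?_
    simp only [Function.mem_support, weightCoeff, dif_pos h] at hγ
    by_cases hS : S ⊆ γ.support
    · rw [if_pos hS] at hγ
      exact ⟨_, mem_support_iff.2 hγ, tsub_add_cancel_of_le (indicatorExp_le hS)⟩
    · exact absurd (if_neg hS) hγ
  · simp [weightCoeff, h]

/-- A chain whose weight coefficients are obtained by contracting, in every weight `γ` outside `C`,
those of `z` in a direction `v γ`. -/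
lemma exists_weightCoeff_eq_koszulH {n : ℕ} (k : ℤ) (z : Ch n k)
    (c : (Fin n →₀ ℕ) → Fin n → ℂ) (P : (Fin n →₀ ℕ) → Prop) (v : (Fin n →₀ ℕ) → Fin n)
    (hv : ∀ γ, P γ → γ (v γ) ≠ 0) :
    ∃ y : Ch n (k + 1), ∀ γ, P γ →
      weightCoeff y γ = koszulH (c γ) (v γ) (weightCoeff z γ) := by
  have hex : ∀ S : cIdx n (k + 1), ∃ p : Rp n, ∀ α, coeff α p =
      koszulH (c (α + indicatorExp S.1)) (v (α + indicatorExp S.1))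
        (weightCoeff z (α + indicatorExp S.1)) S.1 := by
    intro S
    refine exists_coeff_eq _ ?_
    have hfin : (⋃ u : Fin n, Function.support fun γ => weightCoeff z γ (S.1.erase u)).Finite :=
      Set.finite_iUnion fun u => finite_support_weightCoeff z _
    refine (hfin.preimage (f := (· + indicatorExp S.1))
      (add_left_injective _).injOn).subset fun α hα => ?_
    simp only [Set.mem_preimage, Set.mem_iUnion, Function.mem_support]
    refine ⟨v (α + indicatorExp S.1), fun h0 => hα ?_⟩
    simp only [koszulH, h0, mul_zero, ite_self]
  choose y hy using hex
  refine ⟨y, fun γ hγ => funext fun S => ?_⟩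
  rw [weightCoeff]
  split_ifs with hc hS
  · rw [hy, tsub_add_cancel_of_le (indicatorExp_le hS)]
  · rw [koszulH]
    split_ifs with hvS
    · have : ¬ S.erase (v γ) ⊆ γ.support := fun h => hS fun i hi => by
        by_cases hiv : i = v γ
        · rw [hiv]; exact Finsupp.mem_support_iff.2 (hv γ hγ)
        · exact h (Finset.mem_erase.2 ⟨hiv, hi⟩)
      simp [weightCoeff, this]
    · rfl
  · rw [koszulH]
    split_ifs with hvS
    · have : ¬ (((S.erase (v γ)).card : ℤ) = k) := by
        have := Finset.card_erase_add_one hvS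
        omega
      simp [weightCoeff, this]
    · rfl

/-- Every cycle is homologous to a chain with coefficients only in the weights belonging to `C`. -/
lemma exists_sub_bnd_coeff_eq_zero {n : ℕ} (a : Fin n → Fin n → ℤ) (ha : ∀ i j, a j i = - a i j)
    (k : ℤ) (z : Ch n k) (hz : z ∈ Zc a k) :
    ∃ y : Ch n (k + 1), ∀ (T : cIdx n k) (α : Fin n →₀ ℕ),
      ¬ CsetPred a (α + indicatorExp T.1 : Fin n →₀ ℕ) →
        coeff α ((z - bnd a (k + 1) k y) T) = 0 := by
  classical
  have hdir : ∀ γ : Fin n →₀ ℕ, ¬ CsetPred a γ → ∃ v, γ v ≠ 0 ∧ weightScalar a γ v ≠ 0 := by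
    intro γ hγ
    simp only [CsetPred, not_forall, not_or] at hγ
    obtain ⟨v, h1, h2⟩ := hγ
    exact ⟨v, h1, fun h => h2 ((weightScalar_eq_zero_iff a γ v).1 h)⟩
  by_cases hne : Nonempty (Fin n)
  · obtain ⟨i₀⟩ := hne
    let v : (Fin n →₀ ℕ) → Fin n := fun γ => if h : ¬ CsetPred a γ then (hdir γ h).choose else i₀
    have hv : ∀ γ : Fin n →₀ ℕ, ¬ CsetPred a γ → γ (v γ) ≠ 0 ∧ weightScalar a γ (v γ) ≠ 0 := by
      intro γ h
      simp only [v, dif_pos h]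
      exact (hdir γ h).choose_spec
    obtain ⟨y, hy⟩ := exists_weightCoeff_eq_koszulH k z (weightScalar a)
      (fun γ : Fin n →₀ ℕ => ¬ CsetPred a γ) v fun γ h => (hv γ h).1
    refine ⟨y, fun T α hα => ?_⟩
    rw [Pi.sub_apply, coeff_sub, coeff_bnd a ha, hy _ hα,
      koszulD_koszulH _ (hv _ hα).2, weightCoeff_add, sub_self]
    intro S
    rw [← weightCoeff_bnd a ha, LinearMap.mem_ker.1 hz]
    simp [weightCoeff]
  · exact ⟨0, fun T α hα => absurd (fun i => absurd ⟨i⟩ hne) hα⟩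

lemma coeff_bas {n : ℕ} {k : ℤ} (α β : Fin n →₀ ℕ) (S : Finset (Fin n)) (T : cIdx n k) :
    coeff β (bas α S T) = if T.1 = S ∧ α = β then 1 else 0 := by
  by_cases h : T.1 = S <;> simp [bas, h, coeff_monomial]

lemma sum_coeff_smul_bas {n : ℕ} {k : ℤ} (f : Ch n k) :
    ∑ T : cIdx n k, ∑ α ∈ (f T).support, coeff α (f T) • (bas α T.1 : Ch n k) = f := by
  classical
  funext S
  rw [Finset.sum_apply, Finset.sum_eq_single S]
  · rw [Finset.sum_apply]
    conv_rhs => rw [(f S).as_sum]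
    refine Finset.sum_congr rfl fun α _ => ?_
    simp [bas, smul_monomial]
  · intro T _ hT
    rw [Finset.sum_apply]
    refine Finset.sum_eq_zero fun α _ => ?_
    have : S.1 ≠ T.1 := fun h => hT (Subtype.ext h.symm)
    simp [bas, this]
  · simp

lemma coe_add_indicatorExp {n : ℕ} (α : Fin n →₀ ℕ) (S : Finset (Fin n)) :
    ((α + indicatorExp S : Fin n →₀ ℕ) : Fin n → ℕ) = fun i => α i + if i ∈ S then 1 else 0 := rfl

lemma bas_mem_Zc {n : ℕ} (a : Fin n → Fin n → ℤ) (ha : ∀ i j, a j i = - a i j) {k : ℤ}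
    (p : IdxH n a k) : bas p.1.1 p.1.2 ∈ Zc a k := by
  obtain ⟨⟨α, S⟩, hS, hC⟩ := p
  rw [Zc, LinearMap.mem_ker]
  funext T
  ext β
  rw [coeff_bnd a ha, Pi.zero_apply, coeff_zero]
  by_cases hγ : β + indicatorExp T.1 = α + indicatorExp S
  · exact koszulD_eq_zero_of_CsetPred (by rwa [hγ, coe_add_indicatorExp]) _ _
  · refine Finset.sum_eq_zero fun u _ => ?_
    split_ifs with hu
    · rfl
    · have : weightCoeff (bas α S : Ch n k) (β + indicatorExp T.1) (insert u T.1) = 0 := by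
        rw [weightCoeff]
        split_ifs with hc hs
        · rw [coeff_bas, if_neg]
          rintro ⟨h1, h2⟩
          refine hγ ?_
          rw [h2, ← h1, tsub_add_cancel_of_le (indicatorExp_le hs)]
        · rfl
        · rfl
      rw [this]; simp

/-- for `0 ≤ k ≤ n`, the classes of the elements `X^α dX^β` with
`|β| = k` and `α + β ∈ C` form a ℂ-basis of `HP_k(R,M)`: they are cycles, their classes
are linearly independent, and they span the homology. -/
theorem poisson_homology_basis
    (n : ℕ) (hn : 1 ≤ n) (a : Fin n → Fin n → ℤ)
    (ha : ∀ i j, a j i = - a i j) (k : ℕ) (hk : k ≤ n) :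
    ∃ hker : ∀ p : IdxH n a (k : ℤ),
        bas p.1.1 p.1.2 ∈ Zc a (k : ℤ),
      LinearIndependent ℂ
        (fun p : IdxH n a (k : ℤ) =>
          (Bc a (k : ℤ)).mkQ ⟨bas p.1.1 p.1.2, hker p⟩) ∧
      Submodule.span ℂ
        (Set.range (fun p : IdxH n a (k : ℤ) =>
          (Bc a (k : ℤ)).mkQ ⟨bas p.1.1 p.1.2, hker p⟩)) = ⊤ := by
  have hker : ∀ p : IdxH n a (k : ℤ), bas p.1.1 p.1.2 ∈ Zc a (k : ℤ) := bas_mem_Zc a ha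
  refine ⟨hker, ?_, ?_⟩
  · rw [linearIndependent_iff']
    intro s g hg p hp
    simp only [← map_smul, ← map_sum] at hg
    rw [Submodule.mkQ_apply, Submodule.Quotient.mk_eq_zero] at hg
    obtain ⟨y, hy⟩ := hg
    have hcoeff := congrArg (fun f : Ch n k => coeff p.1.1 (f ⟨p.1.2, p.2.1⟩)) hy
    simp only [Submodule.subtype_apply, Submodule.coe_sum, Submodule.coe_smul, Finset.sum_apply,
      Pi.smul_apply, coeff_sum, coeff_smul, coeff_bas] at hcoeff
    rw [coeff_bnd a ha, koszulD_eq_zero_of_CsetPred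
      (by rw [coe_add_indicatorExp]; exact p.2.2), Finset.sum_eq_single p] at hcoeff
    · simpa using hcoeff.symm
    · intro q _ hq
      rw [if_neg, smul_zero]
      rintro ⟨h1, h2⟩
      exact hq (Subtype.ext (Prod.ext h2 h1.symm))
    · exact fun h => absurd hp h
  · rw [eq_top_iff]
    rintro x -
    obtain ⟨⟨z, hz⟩, rfl⟩ := (Bc a (k : ℤ)).mkQ_surjective x
    obtain ⟨y, hy⟩ := exists_sub_bnd_coeff_eq_zero a ha k z hz
    set f : Ch n k := z - bnd a (k + 1) k y with hf
    have hidx : ∀ (T : cIdx n k) (α), α ∈ (f T).support →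
        CsetPred a (fun i => α i + if i ∈ T.1 then 1 else 0) := by
      intro T α hα
      by_contra h
      exact mem_support_iff.1 hα (hy T α h)
    have hmem : f ∈ Submodule.span ℂ
        (Set.range fun p : IdxH n a (k : ℤ) => (bas p.1.1 p.1.2 : Ch n k)) := by
      rw [← sum_coeff_smul_bas f]
      refine Submodule.sum_mem _ fun T _ => Submodule.sum_mem _ fun α hα =>
        Submodule.smul_mem _ _ (Submodule.subset_span ⟨⟨(α, T.1), T.2, hidx T α hα⟩, rfl⟩)
    have hrange : (Set.range fun p : IdxH n a (k : ℤ) => (bas p.1.1 p.1.2 : Ch n k))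
        = (Zc a (k : ℤ)).subtype ''
          Set.range fun p : IdxH n a (k : ℤ) => (⟨bas p.1.1 p.1.2, hker p⟩ : Zc a (k : ℤ)) := by
      rw [← Set.range_comp]; rfl
    rw [hrange, Submodule.span_image] at hmem
    obtain ⟨w, hw, hwf⟩ := hmem
    have hzw : (Bc a (k : ℤ)).mkQ ⟨z, hz⟩ = (Bc a (k : ℤ)).mkQ w := by
      rw [Submodule.mkQ_apply, Submodule.mkQ_apply, Submodule.Quotient.eq]
      refine ⟨y, ?_⟩
      rw [map_sub, hwf, hf]
      simp
    rw [hzw]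
    have hmap := Submodule.mem_map_of_mem (f := (Bc a (k : ℤ)).mkQ) hw
    rw [Submodule.map_span, ← Set.range_comp] at hmap
    exact hmap
end
end
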